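/- Let h, g be symmetric nonnegative measurable stationary functions on (ℝ^d)^k and (ℝ^d)^q respectively, 1 ≤ q ≤ k, with associated factorizations h̄(s) = h(0, s) on (ℝ^d)^{k−1} and ḡ(s) = g(0, s) on (ℝ^d)^{q−1}. Let ϰ : ℝ^d → (0,1] be a probability density with A_4(h̄) < ∞ and A_4(ḡ) < ∞ (where A_4(f) = ∫ ϰ_m^{−1} f^4 for f a function of m variables). Let X ⊆ ℝ^d be compact with ℓ(X) < ∞ and Z = X. Fix 1 ≤ l < r ≤ q with l ≤ k − 1, and set m = k + q − r − l. Then ‖h ⋆_r^l g‖²_{L²(Z × (ℝ^d)^{m−1})} ≤ ℓ(X) √(A_4(h̄) A_4(ḡ)), where in the norm one of the common variables y_1 of the contraction is restricted to X and all other variables range over ℝ^d. -/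

import Mathlib

open MeasureTheory
open scoped ENNReal

/-- Concatenation of three groups of variables into a single `k`-tuple. -/
def comb3 {V : Type*} {a b c k : ℕ} (pf : k = a + b + c)
    (x : Fin a → V) (y : Fin b → V) (z : Fin c → V) : Fin k → V :=
  fun j => Fin.append (Fin.append x y) z (Fin.cast pf j)

theorem aux_sq_mul {α : Type*} [MeasurableSpace α] (μ : Measure α) (f g : α → ℝ≥0∞)
    (hf : AEMeasurable f μ) (hg : AEMeasurable g μ) :
    (∫⁻ z, f z * g z ∂μ) ^ 2 ≤ (∫⁻ z, f z ^ 2 ∂μ) * ∫⁻ z, g z ^ 2 ∂μ := by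
  have h1 := ENNReal.lintegral_mul_le_Lp_mul_Lq μ (Real.HolderConjugate.two_two) hf hg
  have h2 : (∫⁻ z, f z * g z ∂μ) ^ 2 ≤ ((∫⁻ z, f z ^ (2:ℝ) ∂μ) ^ (1 / (2:ℝ)) *
      (∫⁻ z, g z ^ (2:ℝ) ∂μ) ^ (1 / (2:ℝ))) ^ 2 := by
    gcongr
    exact h1
  refine h2.trans (le_of_eq ?_)
  rw [mul_pow, ← ENNReal.rpow_natCast, ← ENNReal.rpow_natCast, ← ENNReal.rpow_mul,
    ← ENNReal.rpow_mul]
  norm_num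

theorem aux_holder {α : Type*} [MeasurableSpace α] (μ : Measure α) (f g : α → ℝ≥0∞)
    (hf : AEMeasurable f μ) (hg : AEMeasurable g μ) :
    (∫⁻ z, f z * g z ∂μ) ≤ ((∫⁻ z, f z ^ 2 ∂μ) * ∫⁻ z, g z ^ 2 ∂μ) ^ (1 / 2 : ℝ) := by
  have := ENNReal.rpow_le_rpow (aux_sq_mul μ f g hf hg) (show (0:ℝ) ≤ 1/2 by norm_num)
  rwa [← ENNReal.rpow_natCast, ← ENNReal.rpow_mul, show ((2:ℕ):ℝ) * (1/2) = 1 by norm_num,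
    ENNReal.rpow_one] at this

/-- weighted Cauchy-Schwarz -/
theorem aux_weight {α : Type*} [MeasurableSpace α] (μ : Measure α) (f k : α → ℝ≥0∞)
    (hf : Measurable f) (hk : Measurable k) (hk0 : ∀ z, k z ≠ 0) (hk1 : ∀ z, k z ≠ ⊤)
    (hint : ∫⁻ z, k z ∂μ ≤ 1) :
    (∫⁻ z, f z ∂μ) ^ 2 ≤ ∫⁻ z, (k z)⁻¹ * f z ^ 2 ∂μ := by
  have key := aux_sq_mul μ (fun z => (k z)⁻¹ ^ (1/2:ℝ) * f z) (fun z => k z ^ (1/2:ℝ))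
    (by fun_prop) (by fun_prop)
  have e0 : ∀ x : ℝ≥0∞, (x ^ (1/2:ℝ)) ^ 2 = x := fun x => by
    rw [← ENNReal.rpow_natCast, ← ENNReal.rpow_mul]; norm_num
  have e1 : ∀ z, (k z)⁻¹ ^ (1/2:ℝ) * f z * k z ^ (1/2:ℝ) = f z := fun z => by
    rw [mul_right_comm, ← ENNReal.mul_rpow_of_nonneg _ _ (by norm_num),
      ENNReal.inv_mul_cancel (hk0 z) (hk1 z), ENNReal.one_rpow, one_mul]
  simp only [e1, mul_pow, e0] at key
  calc _ ≤ _ := key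
    _ ≤ (∫⁻ z, (k z)⁻¹ * f z ^ 2 ∂μ) * 1 := by gcongr
    _ = _ := mul_one _

theorem aux_swap {α β γ : Type*} [MeasurableSpace α] [MeasurableSpace β] [MeasurableSpace γ]
    (μ : Measure α) (ν : Measure β) (ρ : Measure γ) [SFinite μ] [SFinite ν] [SFinite ρ]
    (P : α → γ → ℝ≥0∞) (Q : β → γ → ℝ≥0∞) (hP : Measurable (Function.uncurry P))
    (hQ : Measurable (Function.uncurry Q)) :
    ∫⁻ x, ∫⁻ x', ∫⁻ y, P x y * Q x' y ∂ρ ∂ν ∂μ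
      = ∫⁻ y, (∫⁻ x, P x y ∂μ) * (∫⁻ x', Q x' y ∂ν) ∂ρ := by
  have hQ' : Measurable fun y => ∫⁻ x', Q x' y ∂ν := hQ.lintegral_prod_left'
  have hPx : ∀ x, Measurable (P x) := fun x => hP.comp measurable_prodMk_left
  have hPy : ∀ y, Measurable (fun x => P x y) := fun y => hP.comp measurable_prodMk_right
  have hQy : ∀ y, Measurable (fun x => Q x y) := fun y => hQ.comp measurable_prodMk_right
  calc _ = ∫⁻ x, ∫⁻ y, P x y * (∫⁻ x', Q x' y ∂ν) ∂ρ ∂μ := by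
        refine lintegral_congr fun x => ?_
        rw [lintegral_lintegral_swap]
        · exact lintegral_congr fun y => lintegral_const_mul _ (hQy y)
        · exact (((hPx x).comp measurable_snd).mul hQ).aemeasurable
    _ = _ := by
        rw [lintegral_lintegral_swap]
        · exact lintegral_congr fun y => lintegral_mul_const _ (hPy y)
        · exact (hP.mul (hQ'.comp measurable_snd)).aemeasurable

theorem aux_append {d a b : ℕ} (f : (Fin (a + b) → (Fin d → ℝ)) → ℝ≥0∞) (hf : Measurable f) :
    ∫⁻ s, f s = ∫⁻ x : Fin a → (Fin d → ℝ), ∫⁻ y : Fin b → (Fin d → ℝ), f (Fin.append x y) := by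
  have h1 := (volume_measurePreserving_sumPiEquivProdPi_symm
    (fun _ : Fin a ⊕ Fin b => (Fin d → ℝ)))
  have h2 := (volume_measurePreserving_piCongrLeft (fun _ : Fin (a+b) => (Fin d → ℝ))
    finSumFinEquiv)
  rw [← (h2.comp h1).lintegral_comp hf]
  have hm : Measurable fun p : (Fin a → (Fin d → ℝ)) × (Fin b → (Fin d → ℝ)) =>
      f (Fin.append p.1 p.2) := by
    refine hf.comp (measurable_pi_iff.2 fun i => ?_)
    refine Fin.addCases (fun i => ?_) (fun i => ?_) i
    · simp only [Fin.append_left]; fun_prop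
    · simp only [Fin.append_right]; fun_prop
  rw [← lintegral_prod (fun p : (Fin a → (Fin d → ℝ)) × (Fin b → (Fin d → ℝ)) =>
      f (Fin.append p.1 p.2)) hm.aemeasurable]
  refine lintegral_congr fun p => ?_
  congr 1
  funext i
  refine Fin.addCases (fun i => ?_) (fun i => ?_) i
  · rw [Fin.append_left, ← finSumFinEquiv_apply_left]
    simp [MeasurableEquiv.piCongrLeft, MeasurableEquiv.sumPiEquivProdPi,
      Equiv.piCongrLeft_apply_apply, -finSumFinEquiv_apply_left]
  · rw [Fin.append_right, ← finSumFinEquiv_apply_right]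
    simp [MeasurableEquiv.piCongrLeft, MeasurableEquiv.sumPiEquivProdPi,
      Equiv.piCongrLeft_apply_apply, -finSumFinEquiv_apply_right]

theorem aux_cons {d n : ℕ} (X : Set (Fin d → ℝ)) (hXm : MeasurableSet X)
    (F : (Fin (n + 1) → (Fin d → ℝ)) → ℝ≥0∞) (hF : Measurable F)
    (hinv : ∀ t y, F (fun j => y j + t) = F y) :
    ∫⁻ y in {y : Fin (n + 1) → (Fin d → ℝ) | y 0 ∈ X}, F y
      = volume X * ∫⁻ w : Fin n → (Fin d → ℝ), F (Fin.cons 0 w) := by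
  have h1 := (volume_preserving_piFinSuccAbove (fun _ : Fin (n+1) => (Fin d → ℝ)) 0).symm
  have hS : MeasurableSet {y : Fin (n + 1) → (Fin d → ℝ) | y 0 ∈ X} :=
    (measurable_pi_apply 0) hXm
  have hind := hF.indicator hS
  rw [← lintegral_indicator hS, ← h1.lintegral_comp hind, Measure.volume_eq_prod, lintegral_prod]
  · have e : ∀ (t : Fin d → ℝ) (w : Fin n → (Fin d → ℝ)),
        (MeasurableEquiv.piFinSuccAbove (fun _ : Fin (n+1) => (Fin d → ℝ)) 0).symm (t, w)
          = Fin.cons t w := fun t w => by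
      simp [MeasurableEquiv.piFinSuccAbove, Fin.insertNthEquiv]
    simp only [e]
    have e2 : ∀ t : Fin d → ℝ, ∫⁻ w : Fin n → (Fin d → ℝ),
        Set.indicator {y : Fin (n + 1) → (Fin d → ℝ) | y 0 ∈ X} F (Fin.cons t w)
        = X.indicator (fun _ => ∫⁻ w : Fin n → (Fin d → ℝ), F (Fin.cons 0 w)) t := by
      intro t
      by_cases ht : t ∈ X
      · simp only [Set.indicator, Set.mem_ofPred_eq, Fin.cons_zero, ht, if_true]
        rw [← lintegral_add_right_eq_self (fun w : Fin n → (Fin d → ℝ) => F (Fin.cons t w))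
          (fun _ => t)]
        refine lintegral_congr fun w => ?_
        rw [← hinv t (Fin.cons 0 w)]
        congr 1
        funext j
        refine Fin.cases ?_ (fun j => ?_) j <;> simp
      · simp [Set.indicator, ht]
    simp only [e2]
    rw [lintegral_indicator hXm, setLIntegral_const, mul_comm]
  · exact (hind.comp (MeasurableEquiv.measurable _)).aemeasurable

theorem aux_comb3_meas {V : Type*} [MeasurableSpace V] {a b c k : ℕ} (pf : k = a + b + c) :
    Measurable fun p : (Fin a → V) × (Fin b → V) × (Fin c → V) => comb3 pf p.1 p.2.1 p.2.2 := by
  subst pf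
  refine measurable_pi_iff.2 fun i => ?_
  simp only [comb3, Fin.cast_eq_self]
  refine Fin.addCases (fun i => ?_) (fun i => ?_) i
  · simp only [Fin.append_left]
    refine Fin.addCases (fun i => ?_) (fun i => ?_) i
    · simp only [Fin.append_left]; fun_prop
    · simp only [Fin.append_right]; fun_prop
  · simp only [Fin.append_right]; fun_prop

theorem aux_perm {V : Type*} {a n c k k' : ℕ} (pf : k = a + (n + 1) + c) (pf' : k = k' + 1)
    (pf2 : k' = a + n + c) (h : (Fin k → V) → ℝ)
    (hsym : ∀ (σ : Equiv.Perm (Fin k)) x, h (x ∘ σ) = h x) (v : V)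
    (x : Fin a → V) (w : Fin n → V) (z : Fin c → V) :
    h (comb3 pf x (Fin.cons v w) z)
      = h (fun j => (Fin.cons v (comb3 pf2 x w z) : Fin (k' + 1) → V) (Fin.cast pf' j)) := by
  subst pf'
  subst pf2
  refine Eq.trans ?_ (hsym (Fin.cycleRange ⟨a, by omega⟩) _)
  congr 1
  funext j
  simp only [Function.comp, Fin.cast_eq_self]
  obtain ⟨j, rfl⟩ : ∃ i, j = Fin.cast pf.symm i := ⟨Fin.cast pf j, by simp⟩
  refine Fin.addCases (fun i => ?_) (fun i => ?_) j
  · refine Fin.addCases (fun i => ?_) (fun i => ?_) i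
    · have e : Fin.cycleRange (⟨a, by omega⟩ : Fin (a + n + c + 1))
          (Fin.cast pf.symm (Fin.castAdd c (Fin.castAdd (n+1) i)))
          = Fin.succ (Fin.castAdd c (Fin.castAdd n i)) := by
        rw [Fin.cycleRange_of_lt (by simp [Fin.lt_def])]
        ext
        rw [Fin.val_add_one_of_lt]
        · simp
        · simp [Fin.lt_def]; omega
      rw [e]
      simp [comb3]
    · refine Fin.cases ?_ (fun i => ?_) i
      · have e : Fin.cycleRange (⟨a, by omega⟩ : Fin (a + n + c + 1))
          (Fin.cast pf.symm (Fin.castAdd c (Fin.natAdd a (0 : Fin (n+1)))))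
          = 0 := Fin.cycleRange_of_eq (by ext; simp)
        rw [e]
        simp [comb3]
      · have e : Fin.cycleRange (⟨a, by omega⟩ : Fin (a + n + c + 1))
          (Fin.cast pf.symm (Fin.castAdd c (Fin.natAdd a (Fin.succ i))))
          = Fin.succ (Fin.castAdd c (Fin.natAdd a i)) := by
          rw [Fin.cycleRange_of_gt (by simp [Fin.lt_def])]
          ext
          simp; try omega
        rw [e]
        simp [comb3]
  · have e : Fin.cycleRange (⟨a, by omega⟩ : Fin (a + n + c + 1))
          (Fin.cast pf.symm (Fin.natAdd (a + (n+1)) i))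
          = Fin.succ (Fin.natAdd (a + n) i) := by
      rw [Fin.cycleRange_of_gt (by simp [Fin.lt_def]; omega)]
      ext
      simp; try omega
    rw [e]
    simp [comb3]

theorem aux_comb3_add {V : Type*} [Add V] {a b c k : ℕ} (pf : k = a + b + c)
    (x : Fin a → V) (y : Fin b → V) (z : Fin c → V) (t : V) :
    comb3 pf (fun j => x j + t) (fun j => y j + t) (fun j => z j + t)
      = fun j => comb3 pf x y z j + t := by
  subst pf
  funext j
  simp only [comb3, Fin.cast_eq_self]
  refine Fin.addCases (fun i => ?_) (fun i => ?_) j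
  · simp only [Fin.append_left]
    refine Fin.addCases (fun i => ?_) (fun i => ?_) i <;> simp
  · simp

theorem aux_FInv {d a b c k : ℕ} (pf : k = a + b + c)
    (h : (Fin k → (Fin d → ℝ)) → ℝ)
    (hstat : ∀ (t : Fin d → ℝ) x, h (fun j => x j + t) = h x) (t : Fin d → ℝ)
    (y : Fin b → (Fin d → ℝ)) :
    (∫⁻ x : Fin a → (Fin d → ℝ), ∫⁻ z : Fin c → (Fin d → ℝ),
      ENNReal.ofReal (h (comb3 pf x (fun j => y j + t) z)) ^ 2)
    = ∫⁻ x : Fin a → (Fin d → ℝ), ∫⁻ z : Fin c → (Fin d → ℝ),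
      ENNReal.ofReal (h (comb3 pf x y z)) ^ 2 := by
  rw [← lintegral_add_right_eq_self _ (fun _ => t)]
  refine lintegral_congr fun x => ?_
  rw [← lintegral_add_right_eq_self _ (fun _ => t)]
  refine lintegral_congr fun z => ?_
  rw [← hstat t (comb3 pf x y z), ← aux_comb3_add]
  rfl

theorem aux_prodint {d a : ℕ} (κ : (Fin d → ℝ) → ℝ) (hκ : Measurable κ) (hκpos : ∀ t, 0 < κ t)
    (hκint : ∫ t, κ t = 1) :
    ∫⁻ x : Fin a → (Fin d → ℝ), ∏ i, ENNReal.ofReal (κ (x i)) = 1 := by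
  have h1 : ∫⁻ t, ENNReal.ofReal (κ t) = 1 := by
    rw [← ofReal_integral_eq_lintegral_ofReal, hκint, ENNReal.ofReal_one]
    · by_contra hc
      rw [integral_undef hc] at hκint
      norm_num at hκint
    · exact Filter.Eventually.of_forall fun t => (hκpos t).le
  induction a with
  | zero => simp [volume_pi]
  | succ n ih =>
    have h2 := (volume_preserving_piFinSuccAbove (fun _ : Fin (n+1) => (Fin d → ℝ)) 0).symm
    rw [← h2.lintegral_comp (by fun_prop), Measure.volume_eq_prod]
    have e : ∀ p : (Fin d → ℝ) × (Fin n → (Fin d → ℝ)),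
        ∏ i, ENNReal.ofReal (κ ((MeasurableEquiv.piFinSuccAbove
          (fun _ : Fin (n+1) => (Fin d → ℝ)) 0).symm p i))
        = ENNReal.ofReal (κ p.1) * ∏ i, ENNReal.ofReal (κ (p.2 i)) := fun p => by
      rw [Fin.prod_univ_succ]
      simp [MeasurableEquiv.piFinSuccAbove, Fin.insertNthEquiv]
    simp only [e]
    rw [lintegral_prod_mul (f := fun t => ENNReal.ofReal (κ t))
      (g := fun s : Fin n → (Fin d → ℝ) => ∏ i, ENNReal.ofReal (κ (s i))) (by fun_prop)
      (Measurable.aemeasurable (by fun_prop)), h1, ih, one_mul]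

theorem aux_half {d a n c k k' : ℕ} (pf : k = a + (n + 1) + c) (pf' : k = k' + 1)
    (κ : (Fin d → ℝ) → ℝ) (hκ : Measurable κ) (hκpos : ∀ t, 0 < κ t) (hκle : ∀ t, κ t ≤ 1)
    (hκint : ∫ t, κ t = 1)
    (h : (Fin k → (Fin d → ℝ)) → ℝ) (hmeas : Measurable h) (hnn : ∀ x, 0 ≤ h x)
    (hsym : ∀ (σ : Equiv.Perm (Fin k)) x, h (x ∘ σ) = h x) :
    ∫⁻ w : Fin n → (Fin d → ℝ), (∫⁻ x : Fin a → (Fin d → ℝ), ∫⁻ z : Fin c → (Fin d → ℝ),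
      ENNReal.ofReal (h (comb3 pf x (Fin.cons 0 w) z)) ^ 2) ^ 2
    ≤ ∫⁻ s : Fin k' → (Fin d → ℝ),
      (∏ i, ENNReal.ofReal (κ (s i)))⁻¹ *
        ENNReal.ofReal (h (fun j => (Fin.cons (0 : Fin d → ℝ) s : Fin (k'+1) → (Fin d → ℝ))
          (Fin.cast pf' j)) ^ 4) := by
  have pf2 : k' = a + n + c := by omega
  simp_rw [aux_perm pf pf' pf2 h hsym]
  subst pf2
  set H : (Fin (a + n + c) → (Fin d → ℝ)) → ℝ≥0∞ := fun s =>
    ENNReal.ofReal (h (fun j => (Fin.cons (0 : Fin d → ℝ) s : Fin (a+n+c+1) → (Fin d → ℝ))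
          (Fin.cast pf' j))) with hH
  have hHm : Measurable H := by
    refine ENNReal.measurable_ofReal.comp (hmeas.comp (measurable_pi_iff.2 fun j => ?_))
    generalize Fin.cast pf' j = i
    refine Fin.cases ?_ (fun i => ?_) i
    · simp
    · simp only [Fin.cons_succ]; fun_prop
  have hc := aux_comb3_meas (V := Fin d → ℝ) (rfl : a + n + c = a + n + c)
  have hcH := hHm.comp hc
  simp only [ENNReal.ofReal_pow (hnn _)]
  change ∫⁻ w : Fin n → (Fin d → ℝ), (∫⁻ x : Fin a → (Fin d → ℝ), ∫⁻ z : Fin c → (Fin d → ℝ),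
      H (comb3 rfl x w z) ^ 2) ^ 2 ≤ ∫⁻ s, (∏ i, ENNReal.ofReal (κ (s i)))⁻¹ * H s ^ 4
  have hKm : ∀ m, Measurable fun s : Fin m → (Fin d → ℝ) => ∏ i, ENNReal.ofReal (κ (s i)) := by
    intro m; fun_prop
  have hK0 : ∀ m (s : Fin m → (Fin d → ℝ)), ∏ i, ENNReal.ofReal (κ (s i)) ≠ 0 := by
    intro m s
    exact Finset.prod_ne_zero_iff.2 fun i _ => by simpa using hκpos _
  have hK1 : ∀ m (s : Fin m → (Fin d → ℝ)), ∏ i, ENNReal.ofReal (κ (s i)) ≤ 1 := by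
    intro m s
    exact Finset.prod_le_one' fun i _ => by simpa using hκle _
  have hKt : ∀ m (s : Fin m → (Fin d → ℝ)), ∏ i, ENNReal.ofReal (κ (s i)) ≠ ⊤ := by
    intro m s
    exact ((hK1 m s).trans_lt ENNReal.one_lt_top).ne
  have hcw : ∀ w, Measurable fun p : (Fin a → (Fin d → ℝ)) × (Fin c → (Fin d → ℝ)) =>
      H (comb3 rfl p.1 w p.2) := fun w =>
    hcH.comp (g := fun p : (Fin a → (Fin d → ℝ)) × (Fin n → (Fin d → ℝ)) × (Fin c → (Fin d → ℝ))
      => H (comb3 rfl p.1 p.2.1 p.2.2))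
      (f := fun p : (Fin a → (Fin d → ℝ)) × (Fin c → (Fin d → ℝ)) => (p.1, w, p.2)) (by fun_prop)
  have step : ∀ w : Fin n → (Fin d → ℝ),
      (∫⁻ x : Fin a → (Fin d → ℝ), ∫⁻ z : Fin c → (Fin d → ℝ), H (comb3 rfl x w z) ^ 2) ^ 2
      ≤ ∫⁻ x : Fin a → (Fin d → ℝ), ∫⁻ z : Fin c → (Fin d → ℝ),
        ((∏ i, ENNReal.ofReal (κ (x i))) * (∏ i, ENNReal.ofReal (κ (w i))) *
          ∏ i, ENNReal.ofReal (κ (z i)))⁻¹ * H (comb3 rfl x w z) ^ 4 := by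
    intro w
    have kw := aux_weight ((volume : Measure (Fin a → (Fin d → ℝ))).prod
      (volume : Measure (Fin c → (Fin d → ℝ)))) (fun p => H (comb3 rfl p.1 w p.2) ^ 2)
      (fun p => (∏ i, ENNReal.ofReal (κ (p.1 i))) * ∏ i, ENNReal.ofReal (κ (p.2 i)))
      ((hcw w).pow_const 2) (by fun_prop)
      (fun p => mul_ne_zero (hK0 _ _) (hK0 _ _)) (fun p => ENNReal.mul_ne_top (hKt _ _) (hKt _ _))
      (by
        rw [lintegral_prod_mul (hKm a).aemeasurable (hKm c).aemeasurable,
          aux_prodint κ hκ hκpos hκint, aux_prodint κ hκ hκpos hκint, one_mul])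
    rw [lintegral_prod _ ((hcw w).pow_const 2).aemeasurable, lintegral_prod] at kw
    · refine kw.trans ?_
      refine lintegral_mono fun x => lintegral_mono fun z => ?_
      simp only [← pow_mul]
      gcongr
      · exact mul_le_of_le_one_right' (hK1 _ _)
    · exact Measurable.aemeasurable (Measurable.mul (by fun_prop) (((hcw w).pow_const 2).pow_const 2))
  refine (lintegral_mono step).trans (le_of_eq ?_)
  set f : (Fin (a + n + c) → (Fin d → ℝ)) → ℝ≥0∞ :=
    fun s => (∏ i, ENNReal.ofReal (κ (s i)))⁻¹ * H s ^ 4 with hf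
  have hfm : Measurable f := (hKm _).inv.mul (hHm.pow_const 4)
  have e : ∀ x w z, ((∏ i, ENNReal.ofReal (κ (x i))) * (∏ i, ENNReal.ofReal (κ (w i))) *
          ∏ i, ENNReal.ofReal (κ (z i)))⁻¹ * H (comb3 rfl x w z) ^ 4 = f (comb3 rfl x w z) := by
    intro x w z
    simp only [hf]
    rw [Fin.prod_univ_add, Fin.prod_univ_add]
    simp [comb3]
  simp only [e]
  have hfc : Measurable fun p : (Fin a → (Fin d → ℝ)) × (Fin n → (Fin d → ℝ)) ×
      (Fin c → (Fin d → ℝ)) => f (comb3 rfl p.1 p.2.1 p.2.2) := hfm.comp hc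
  have hfc1 : Measurable fun p : ((Fin a → (Fin d → ℝ)) × (Fin n → (Fin d → ℝ))) ×
      (Fin c → (Fin d → ℝ)) => f (comb3 rfl p.1.1 p.1.2 p.2) :=
    hfc.comp (f := fun p : ((Fin a → (Fin d → ℝ)) × (Fin n → (Fin d → ℝ))) ×
      (Fin c → (Fin d → ℝ)) => (p.1.1, p.1.2, p.2)) (by fun_prop)
  have hfc2 : Measurable fun u : Fin (a + n) → (Fin d → ℝ) =>
      ∫⁻ z : Fin c → (Fin d → ℝ), f (Fin.append u z) := by
    refine Measurable.lintegral_prod_right' (f := fun p : (Fin (a + n) → (Fin d → ℝ)) ×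
      (Fin c → (Fin d → ℝ)) => f (Fin.append p.1 p.2)) ?_
    refine hfm.comp (measurable_pi_iff.2 fun i => ?_)
    refine Fin.addCases (fun i => ?_) (fun i => ?_) i
    · simp only [Fin.append_left]; fun_prop
    · simp only [Fin.append_right]; fun_prop
  rw [aux_append f hfm, aux_append _ hfc2, lintegral_lintegral_swap]
  · rfl
  · exact (hfc1.lintegral_prod_right'.comp measurable_swap).aemeasurable

theorem aux_core (d k q a a' b c k' q' : ℕ) (hb : 0 < b) (pk : k = a + b + c)
    (pq : q = a' + b + c) (pk' : k = k' + 1) (pq' : q = q' + 1)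
    (X : Set (Fin d → ℝ)) (hXm : MeasurableSet X)
    (κ : (Fin d → ℝ) → ℝ) (hκ : Measurable κ) (hκpos : ∀ t, 0 < κ t) (hκle : ∀ t, κ t ≤ 1)
    (hκint : ∫ t, κ t = 1)
    (h : (Fin k → (Fin d → ℝ)) → ℝ) (g : (Fin q → (Fin d → ℝ)) → ℝ)
    (hmeas : Measurable h) (gmeas : Measurable g)
    (hnn : ∀ x, 0 ≤ h x) (gnn : ∀ x, 0 ≤ g x)
    (hsym : ∀ (σ : Equiv.Perm (Fin k)) x, h (x ∘ σ) = h x)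
    (gsym : ∀ (σ : Equiv.Perm (Fin q)) x, g (x ∘ σ) = g x)
    (hstat : ∀ (t : Fin d → ℝ) x, h (fun j => x j + t) = h x)
    (gstat : ∀ (t : Fin d → ℝ) x, g (fun j => x j + t) = g x) :
    (∫⁻ x : Fin a → (Fin d → ℝ), ∫⁻ x' : Fin a' → (Fin d → ℝ),
      ∫⁻ y in {y : Fin b → (Fin d → ℝ) | y ⟨0, hb⟩ ∈ X},
        (∫⁻ z : Fin c → (Fin d → ℝ),
          ENNReal.ofReal (h (comb3 pk x y z)) *
            ENNReal.ofReal (g (comb3 pq x' y z))) ^ 2)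
    ≤ volume X * ((∫⁻ s : Fin k' → (Fin d → ℝ),
      (∏ i, ENNReal.ofReal (κ (s i)))⁻¹ *
        ENNReal.ofReal (h (fun j => (Fin.cons (0 : Fin d → ℝ) s : Fin (k'+1) → (Fin d → ℝ)) (Fin.cast pk' j)) ^ 4)) * (∫⁻ s : Fin q' → (Fin d → ℝ),
      (∏ i, ENNReal.ofReal (κ (s i)))⁻¹ *
        ENNReal.ofReal (g (fun j => (Fin.cons (0 : Fin d → ℝ) s : Fin (q'+1) → (Fin d → ℝ)) (Fin.cast pq' j)) ^ 4))) ^ (1 / 2 : ℝ) := by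
  obtain ⟨n, rfl⟩ : ∃ n, b = n + 1 := ⟨b - 1, by omega⟩
  have mh : Measurable fun p : (Fin a → (Fin d → ℝ)) × (Fin (n+1) → (Fin d → ℝ)) ×
      (Fin c → (Fin d → ℝ)) => ENNReal.ofReal (h (comb3 pk p.1 p.2.1 p.2.2)) :=
    ENNReal.measurable_ofReal.comp (hmeas.comp (aux_comb3_meas pk))
  have mg : Measurable fun p : (Fin a' → (Fin d → ℝ)) × (Fin (n+1) → (Fin d → ℝ)) ×
      (Fin c → (Fin d → ℝ)) => ENNReal.ofReal (g (comb3 pq p.1 p.2.1 p.2.2)) :=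
    ENNReal.measurable_ofReal.comp (gmeas.comp (aux_comb3_meas pq))
  have mP : Measurable (Function.uncurry fun (x : Fin a → (Fin d → ℝ))
      (y : Fin (n+1) → (Fin d → ℝ)) => ∫⁻ z : Fin c → (Fin d → ℝ),
        ENNReal.ofReal (h (comb3 pk x y z)) ^ 2) :=
    Measurable.lintegral_prod_right' ((mh.pow_const 2).comp
      (f := fun p : ((Fin a → (Fin d → ℝ)) × (Fin (n+1) → (Fin d → ℝ))) ×
      (Fin c → (Fin d → ℝ)) => (p.1.1, p.1.2, p.2)) (by fun_prop))
  have mQ : Measurable (Function.uncurry fun (x : Fin a' → (Fin d → ℝ))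
      (y : Fin (n+1) → (Fin d → ℝ)) => ∫⁻ z : Fin c → (Fin d → ℝ),
        ENNReal.ofReal (g (comb3 pq x y z)) ^ 2) :=
    Measurable.lintegral_prod_right' ((mg.pow_const 2).comp
      (f := fun p : ((Fin a' → (Fin d → ℝ)) × (Fin (n+1) → (Fin d → ℝ))) ×
      (Fin c → (Fin d → ℝ)) => (p.1.1, p.1.2, p.2)) (by fun_prop))
  have mP' := mP.lintegral_prod_left' (μ := volume)
  have mQ' := mQ.lintegral_prod_left' (μ := volume)
  simp only [Function.uncurry] at mP' mQ'
  have mcons : Measurable fun w : Fin n → (Fin d → ℝ) =>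
      (Fin.cons 0 w : Fin (n+1) → (Fin d → ℝ)) := by
    refine measurable_pi_iff.2 fun i => ?_
    refine Fin.cases ?_ (fun i => ?_) i
    · simp
    · simp only [Fin.cons_succ]; fun_prop
  calc _ ≤ ∫⁻ x : Fin a → (Fin d → ℝ), ∫⁻ x' : Fin a' → (Fin d → ℝ),
      ∫⁻ y in {y : Fin (n+1) → (Fin d → ℝ) | y 0 ∈ X},
        (∫⁻ z : Fin c → (Fin d → ℝ), ENNReal.ofReal (h (comb3 pk x y z)) ^ 2) *
        (∫⁻ z : Fin c → (Fin d → ℝ), ENNReal.ofReal (g (comb3 pq x' y z)) ^ 2) := by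
        refine lintegral_mono fun x => lintegral_mono fun x' => lintegral_mono fun y => ?_
        refine aux_sq_mul _ _ _ ?_ ?_
        · exact (mh.comp (f := fun z => (x, y, z)) (by fun_prop)).aemeasurable
        · exact (mg.comp (f := fun z => (x', y, z)) (by fun_prop)).aemeasurable
    _ = _ := aux_swap _ _ _ _ _ mP mQ
    _ = _ := aux_cons X hXm _ (mP'.mul mQ') (fun t y => by
        rw [aux_FInv pk h hstat, aux_FInv pq g gstat])
    _ ≤ _ := by
        gcongr
        refine (aux_holder _ _ _ (mP'.comp mcons).aemeasurable
          (mQ'.comp mcons).aemeasurable).trans ?_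
        gcongr
        · exact aux_half pk pk' κ hκ hκpos hκle hκint h hmeas hnn hsym
        · exact aux_half pq pq' κ hκ hκpos hκle hκint g gmeas gnn gsym

/-- the case `r - l > 0` of Lemma 4.9 (without marks):
`‖h ⋆_r^l g‖²_{L²(X × (ℝ^d)^{m-1})} ≤ ℓ(X) √(A₄(h̄) A₄(ḡ))`, where the first of the
common variables `y` of the contraction is restricted to `X`. -/
theorem stmt_16 (d k q r l : ℕ) (hl : 1 ≤ l) (hlr : l < r) (hrq : r ≤ q) (hqk : q ≤ k)
    (X : Set (Fin d → ℝ)) (hX : IsCompact X) (hXm : MeasurableSet X)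
    (κ : (Fin d → ℝ) → ℝ) (hκ : Measurable κ) (hκpos : ∀ t, 0 < κ t) (hκle : ∀ t, κ t ≤ 1)
    (hκint : ∫ t, κ t = 1)
    (h : (Fin k → (Fin d → ℝ)) → ℝ) (g : (Fin q → (Fin d → ℝ)) → ℝ)
    (hmeas : Measurable h) (gmeas : Measurable g)
    (hnn : ∀ x, 0 ≤ h x) (gnn : ∀ x, 0 ≤ g x)
    (hsym : ∀ (σ : Equiv.Perm (Fin k)) x, h (x ∘ σ) = h x)
    (gsym : ∀ (σ : Equiv.Perm (Fin q)) x, g (x ∘ σ) = g x)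
    (hstat : ∀ (t : Fin d → ℝ) x, h (fun j => x j + t) = h x)
    (gstat : ∀ (t : Fin d → ℝ) x, g (fun j => x j + t) = g x)
    (A4h A4g : ℝ≥0∞)
    (hA4h : A4h = ∫⁻ s : Fin (k - 1) → (Fin d → ℝ),
      (∏ i, ENNReal.ofReal (κ (s i)))⁻¹ *
        ENNReal.ofReal (h (fun j => (Fin.cons (0 : Fin d → ℝ) s : Fin ((k-1)+1) → (Fin d → ℝ)) (Fin.cast (show k = (k-1)+1 by omega) j)) ^ 4))
    (hA4g : A4g = ∫⁻ s : Fin (q - 1) → (Fin d → ℝ),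
      (∏ i, ENNReal.ofReal (κ (s i)))⁻¹ *
        ENNReal.ofReal (g (fun j => (Fin.cons (0 : Fin d → ℝ) s : Fin ((q-1)+1) → (Fin d → ℝ)) (Fin.cast (show q = (q-1)+1 by omega) j)) ^ 4))
    (hfin : A4h ≠ ⊤) (gfin : A4g ≠ ⊤) :
    (∫⁻ x : Fin (k - r) → (Fin d → ℝ), ∫⁻ x' : Fin (q - r) → (Fin d → ℝ),
      ∫⁻ y in {y : Fin (r - l) → (Fin d → ℝ) | y ⟨0, by omega⟩ ∈ X},
        (∫⁻ z : Fin l → (Fin d → ℝ),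
          ENNReal.ofReal (h (comb3 (show k = (k-r)+(r-l)+l by omega) x y z)) *
            ENNReal.ofReal (g (comb3 (show q = (q-r)+(r-l)+l by omega) x' y z))) ^ 2)
    ≤ volume X * (A4h * A4g) ^ (1 / 2 : ℝ) := by
  subst hA4h hA4g
  exact aux_core d k q (k - r) (q - r) (r - l) l (k - 1) (q - 1) (by omega) _ _ _ _ X hXm κ hκ hκpos
    hκle hκint h g hmeas gmeas hnn gnn hsym gsym hstat gstat
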